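/- Let r be a strictly positive probability mass function on 𝒵 × 𝒞 with marginal r_Z(z) = Σ_c r(z,c), let s : 𝒵 × 𝒞 → ℝ be strictly positive with Σ_c s(z,c) = 1 for every z ∈ 𝒵, and let g : 𝒵 → ℝ be any function. Then the evidence lower bound L := Σ_z r_Z(z) g(z) − Σ_z r_Z(z) log r_Z(z) is bounded below by the hierarchical evidence lower bound L' := Σ_{z,c} r(z,c) g(z) − Σ_{z,c} r(z,c) log r(z,c) + Σ_{z,c} r(z,c) log s(z,c); that is, L ≥ L'. -/

import Mathlib

open Finset

/-- The log-sum inequality for positive weights. -/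
theorem sum_mul_log_sub_log_le {ι : Type*} [Fintype ι] [Nonempty ι] (a b : ι → ℝ)
    (ha : ∀ i, 0 < a i) (hb : ∀ i, 0 < b i) :
    ∑ i, a i * (Real.log (b i) - Real.log (a i)) ≤
      (∑ i, a i) * (Real.log (∑ i, b i) - Real.log (∑ i, a i)) := by
  have hA : 0 < ∑ i, a i := sum_pos (fun i _ => ha i) univ_nonempty
  have hB : 0 < ∑ i, b i := sum_pos (fun i _ => hb i) univ_nonempty
  set A := ∑ i, a i with hAdef
  set B := ∑ i, b i with hBdef
  have key : ∀ i, a i * (Real.log (b i) - Real.log (a i)) ≤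
      a i * (Real.log B - Real.log A) + (b i * (A / B) - a i) := by
    intro i
    have hai := ha i
    have hbi := hb i
    have h := mul_le_mul_of_nonneg_left
      (Real.log_le_sub_one_of_pos (x := b i * A / (a i * B)) (by positivity)) hai.le
    rw [Real.log_div (by positivity) (by positivity), Real.log_mul hbi.ne' hA.ne',
      Real.log_mul hai.ne' hB.ne'] at h
    have e : a i * (b i * A / (a i * B) - 1) = b i * (A / B) - a i := by
      field_simp
    linarith
  refine (sum_le_sum fun i _ => key i).trans_eq ?_
  rw [sum_add_distrib, sum_sub_distrib, ← sum_mul, ← sum_mul, ← hAdef, ← hBdef,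
    mul_div_cancel₀ _ hB.ne', sub_self, add_zero]

/-- The evidence lower bound dominates the hierarchical evidence lower bound:
for a strictly positive pmf `r` on `Z × C` with marginal `r_Z`, any strictly positive `s`
with `∑ c, s(z,c) = 1` for each `z`, and any `g : Z → ℝ`,
`∑ z, r_Z z * g z - ∑ z, r_Z z * log (r_Z z) ≥ ∑ r g - ∑ r log r + ∑ r log s`. -/
theorem elbo_ge_hierarchical_elbo
    {Z C : Type*} [Fintype Z] [Fintype C] [Nonempty Z] [Nonempty C]
    (r s : Z × C → ℝ) (g : Z → ℝ)
    (hrpos : ∀ p, 0 < r p) (hrsum : ∑ p, r p = 1)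
    (hspos : ∀ p, 0 < s p) (hssum : ∀ z, ∑ c, s (z, c) = 1) :
    (∑ z, (∑ c, r (z, c)) * g z) - ∑ z, (∑ c, r (z, c)) * Real.log (∑ c, r (z, c)) ≥
      (∑ z, ∑ c, r (z, c) * g z) - (∑ z, ∑ c, r (z, c) * Real.log (r (z, c))) +
        ∑ z, ∑ c, r (z, c) * Real.log (s (z, c)) := by
  have h := sum_le_sum fun z (_ : z ∈ univ) => sum_mul_log_sub_log_le
    (fun c => r (z, c)) (fun c => s (z, c)) (fun c => hrpos (z, c)) fun c => hspos (z, c)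
  simp only [hssum, Real.log_one, zero_sub, mul_neg, mul_sub, sum_sub_distrib,
    sum_neg_distrib] at h
  simp only [sum_mul] at h ⊢
  linarith
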